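/- For all integers m ≥ n ≥ 1, the price of envy-freeness is monotone in the number of items: p_envy(n,m) ≤ p_envy(n,m+1). -/

import Mathlib

open Finset

/-- A utility matrix for `n` agents and `m` items: `x i j` is the (nonnegative)
utility of agent `j` for item `i`, and each agent's utilities sum to `1`. -/
def IsUtilMatrix (n m : ℕ) (x : Fin m → Fin n → ℝ) : Prop :=
  (∀ i j, 0 ≤ x i j) ∧ (∀ j, ∑ i, x i j = 1)

/-- The utility that agent `j` assigns to the bundle of items allocated to
agent `j'` by the allocation `A`. -/
def bundleUtil {n m : ℕ} (x : Fin m → Fin n → ℝ) (A : Fin m → Fin n)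
    (j j' : Fin n) : ℝ :=
  ∑ i ∈ Finset.univ.filter (fun i => A i = j'), x i j

/-- The allocation `A` is envy-free: no agent values another agent's bundle
more than its own. -/
def EnvyFree {n m : ℕ} (x : Fin m → Fin n → ℝ) (A : Fin m → Fin n) : Prop :=
  ∀ j j', bundleUtil x A j j ≥ bundleUtil x A j j'

/-- The welfare of allocation `A`: the sum of the agents' utilities for
their own bundles. -/
def welfare {n m : ℕ} (x : Fin m → Fin n → ℝ) (A : Fin m → Fin n) : ℝ :=
  ∑ j, bundleUtil x A j j

/-- Optimal welfare over all allocations. -/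
noncomputable def uStar (n m : ℕ) (x : Fin m → Fin n → ℝ) : ℝ :=
  sSup {w : ℝ | ∃ A : Fin m → Fin n, w = welfare x A}

/-- Optimal welfare over all envy-free allocations. -/
noncomputable def uStarF (n m : ℕ) (x : Fin m → Fin n → ℝ) : ℝ :=
  sSup {w : ℝ | ∃ A : Fin m → Fin n, EnvyFree x A ∧ w = welfare x A}

/-- The price of envy-freeness for `n` agents and `m` items: the supremum of
`uStar x / uStarF x` over all utility matrices admitting an envy-free
allocation. -/
noncomputable def pEnvy (n m : ℕ) : ℝ :=
  sSup {r : ℝ | ∃ x : Fin m → Fin n → ℝ, IsUtilMatrix n m x ∧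
    (∃ A : Fin m → Fin n, EnvyFree x A) ∧ r = uStar n m x / uStarF n m x}

/-- The utility matrix obtained from `x` by adding an item that every agent values at `0`. -/
def addNullItem {n m : ℕ} (x : Fin m → Fin n → ℝ) : Fin (m + 1) → Fin n → ℝ :=
  Fin.snoc (α := fun _ => Fin n → ℝ) x 0

section addNullItem

variable {n m : ℕ} {x : Fin m → Fin n → ℝ}

lemma IsUtilMatrix.addNullItem (hx : IsUtilMatrix n m x) :
    IsUtilMatrix n (m + 1) (addNullItem x) := by
  refine ⟨fun i j => ?_, fun j => ?_⟩
  · induction i using Fin.lastCases with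
    | last => simp [_root_.addNullItem]
    | cast i => simpa [_root_.addNullItem] using hx.1 i j
  · simpa [_root_.addNullItem, Fin.sum_univ_castSucc] using hx.2 j

lemma bundleUtil_addNullItem (x : Fin m → Fin n → ℝ) (B : Fin (m + 1) → Fin n) (j j' : Fin n) :
    bundleUtil (addNullItem x) B j j' = bundleUtil x (fun i => B i.castSucc) j j' := by
  simp [bundleUtil, addNullItem, Finset.sum_filter, Fin.sum_univ_castSucc]

lemma envyFree_addNullItem (x : Fin m → Fin n → ℝ) (B : Fin (m + 1) → Fin n) :
    EnvyFree (addNullItem x) B ↔ EnvyFree x (fun i => B i.castSucc) := by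
  simp only [EnvyFree, bundleUtil_addNullItem]

lemma welfare_addNullItem (x : Fin m → Fin n → ℝ) (B : Fin (m + 1) → Fin n) :
    welfare (addNullItem x) B = welfare x (fun i => B i.castSucc) := by
  simp only [welfare, bundleUtil_addNullItem]

/-- Quantifying over allocations of `m` items amounts to quantifying over the restrictions of
allocations of `m + 1` items. -/
lemma exists_allocation_castSucc (hn : 1 ≤ n) (P : (Fin m → Fin n) → Prop) :
    (∃ B : Fin (m + 1) → Fin n, P (fun i => B i.castSucc)) ↔ ∃ A, P A := by
  refine ⟨fun ⟨B, hB⟩ => ⟨_, hB⟩, fun ⟨A, hA⟩ => ?_⟩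
  exact ⟨Fin.snoc (α := fun _ => Fin n) A ⟨0, hn⟩, by simpa using hA⟩

lemma uStar_addNullItem (hn : 1 ≤ n) (x : Fin m → Fin n → ℝ) :
    uStar n (m + 1) (addNullItem x) = uStar n m x := by
  simp only [uStar, welfare_addNullItem]
  congr 1
  ext w
  exact exists_allocation_castSucc hn fun A => w = welfare x A

lemma uStarF_addNullItem (hn : 1 ≤ n) (x : Fin m → Fin n → ℝ) :
    uStarF n (m + 1) (addNullItem x) = uStarF n m x := by
  simp only [uStarF, welfare_addNullItem, envyFree_addNullItem]
  congr 1
  ext w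
  exact exists_allocation_castSucc hn fun A => EnvyFree x A ∧ w = welfare x A

end addNullItem

section bounds

variable {n m : ℕ} {x : Fin m → Fin n → ℝ}

lemma IsUtilMatrix.bundleUtil_nonneg (hx : IsUtilMatrix n m x) (A : Fin m → Fin n)
    (j j' : Fin n) : 0 ≤ bundleUtil x A j j' :=
  Finset.sum_nonneg fun i _ => hx.1 i j

lemma IsUtilMatrix.sum_bundleUtil (hx : IsUtilMatrix n m x) (A : Fin m → Fin n) (j : Fin n) :
    ∑ j', bundleUtil x A j j' = 1 := by
  rw [← hx.2 j]
  exact Finset.sum_fiberwise _ _ _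

lemma IsUtilMatrix.welfare_nonneg (hx : IsUtilMatrix n m x) (A : Fin m → Fin n) :
    0 ≤ welfare x A :=
  Finset.sum_nonneg fun j _ => hx.bundleUtil_nonneg A j j

lemma IsUtilMatrix.welfare_le (hx : IsUtilMatrix n m x) (A : Fin m → Fin n) :
    welfare x A ≤ n := by
  calc welfare x A ≤ ∑ _j : Fin n, (1 : ℝ) := by
        refine Finset.sum_le_sum fun j _ => ?_
        rw [← hx.sum_bundleUtil A j]
        exact Finset.single_le_sum (fun j' _ => hx.bundleUtil_nonneg A j j') (Finset.mem_univ j)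
    _ = n := by simp

lemma IsUtilMatrix.one_le_welfare (hn : 1 ≤ n) (hx : IsUtilMatrix n m x) {A : Fin m → Fin n}
    (hA : EnvyFree x A) : 1 ≤ welfare x A := by
  have hn0 : (0 : ℝ) < n := by exact_mod_cast hn
  have h : ∀ j, 1 ≤ n * bundleUtil x A j j := fun j => by
    calc (1 : ℝ) = ∑ j', bundleUtil x A j j' := (hx.sum_bundleUtil A j).symm
      _ ≤ ∑ _j' : Fin n, bundleUtil x A j j := Finset.sum_le_sum fun j' _ => hA j j'
      _ = n * bundleUtil x A j j := by simp
  have hsum : (n : ℝ) * 1 ≤ n * welfare x A := by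
    calc (n : ℝ) * 1 = ∑ _j : Fin n, (1 : ℝ) := by simp
      _ ≤ ∑ j, n * bundleUtil x A j j := Finset.sum_le_sum fun j _ => h j
      _ = n * welfare x A := by rw [welfare, Finset.mul_sum]
  exact le_of_mul_le_mul_left hsum hn0

lemma IsUtilMatrix.uStar_nonneg (hx : IsUtilMatrix n m x) : 0 ≤ uStar n m x := by
  apply Real.sSup_nonneg
  rintro _ ⟨A, rfl⟩
  exact hx.welfare_nonneg A

lemma IsUtilMatrix.uStar_le (hx : IsUtilMatrix n m x) : uStar n m x ≤ n := by
  refine Real.sSup_le ?_ n.cast_nonneg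
  rintro _ ⟨A, rfl⟩
  exact hx.welfare_le A

lemma IsUtilMatrix.one_le_uStarF (hn : 1 ≤ n) (hx : IsUtilMatrix n m x)
    (hef : ∃ A : Fin m → Fin n, EnvyFree x A) : 1 ≤ uStarF n m x := by
  obtain ⟨A, hA⟩ := hef
  refine (hx.one_le_welfare hn hA).trans (le_csSup ⟨n, ?_⟩ ⟨A, hA, rfl⟩)
  rintro _ ⟨B, -, rfl⟩
  exact hx.welfare_le B

lemma IsUtilMatrix.uStar_div_uStarF_nonneg (hn : 1 ≤ n) (hx : IsUtilMatrix n m x)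
    (hef : ∃ A : Fin m → Fin n, EnvyFree x A) : 0 ≤ uStar n m x / uStarF n m x :=
  div_nonneg hx.uStar_nonneg (zero_le_one.trans (hx.one_le_uStarF hn hef))

lemma IsUtilMatrix.uStar_div_uStarF_le (hn : 1 ≤ n) (hx : IsUtilMatrix n m x)
    (hef : ∃ A : Fin m → Fin n, EnvyFree x A) : uStar n m x / uStarF n m x ≤ n :=
  (div_le_self hx.uStar_nonneg (hx.one_le_uStarF hn hef)).trans hx.uStar_le

end bounds

/-- For all integers `m ≥ n ≥ 1`, the price of envy-freeness is monotone in
the number of items: `p_envy(n,m) ≤ p_envy(n,m+1)`. -/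
theorem pEnvy_mono_items (n m : ℕ) (hn : 1 ≤ n) (hm : n ≤ m) :
    pEnvy n m ≤ pEnvy n (m + 1) := by
  refine Real.sSup_le ?_ (Real.sSup_nonneg ?_)
  · rintro _ ⟨x, hx, hef, rfl⟩
    refine le_csSup ⟨n, ?_⟩ ⟨addNullItem x, hx.addNullItem, ?_, ?_⟩
    · rintro _ ⟨y, hy, hef', rfl⟩
      exact hy.uStar_div_uStarF_le hn hef'
    · simp only [envyFree_addNullItem]
      exact (exists_allocation_castSucc hn (EnvyFree x)).2 hef
    · rw [uStar_addNullItem hn, uStarF_addNullItem hn]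
  · rintro _ ⟨y, hy, hef, rfl⟩
    exact hy.uStar_div_uStarF_nonneg hn hef
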